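/- arXiv:1705.06393 — 2 statements merged into one kernel-verified Lean document; each statement's English description precedes it below -/
import Mathlib

section
/- There is a bijection between the set of GL₂(ℤ)-equivalence classes of integral binary cubic forms and the set of isomorphism classes of cubic rings, induced by the map f ↦ R(f); moreover, under this correspondence the discriminant of the form f equals the discriminant of the cubic ring R(f). -/
/-- The action of an integer 2×2 matrix `γ` on the coefficient vector `x = (a,b,c,d)` of the
integral binary cubic form `a u³ + b u²v + c uv² + d v³`, given by `(γ·f)(u,v) = f((u,v)·γ)`
(untwisted). -/
def cubicAct (g : Matrix (Fin 2) (Fin 2) ℤ) (x : Fin 4 → ℤ) : Fin 4 → ℤ :=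
  ![x 0 * g 0 0 ^ 3 + x 1 * g 0 0 ^ 2 * g 0 1 + x 2 * g 0 0 * g 0 1 ^ 2 + x 3 * g 0 1 ^ 3,
    3 * x 0 * g 0 0 ^ 2 * g 1 0 + x 1 * (g 0 0 ^ 2 * g 1 1 + 2 * g 0 0 * g 0 1 * g 1 0)
      + x 2 * (2 * g 0 0 * g 0 1 * g 1 1 + g 1 0 * g 0 1 ^ 2) + 3 * x 3 * g 0 1 ^ 2 * g 1 1,
    3 * x 0 * g 0 0 * g 1 0 ^ 2 + x 1 * (2 * g 0 0 * g 1 0 * g 1 1 + g 1 0 ^ 2 * g 0 1)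
      + x 2 * (g 0 0 * g 1 1 ^ 2 + 2 * g 1 0 * g 0 1 * g 1 1) + 3 * x 3 * g 0 1 * g 1 1 ^ 2,
    x 0 * g 1 0 ^ 3 + x 1 * g 1 0 ^ 2 * g 1 1 + x 2 * g 1 0 * g 1 1 ^ 2 + x 3 * g 1 1 ^ 3]

/-- `GL₂(ℤ)`-equivalence of integral binary cubic forms under the twisted action
`(γ·f)(u,v) = det(γ)⁻¹ · f((u,v)·γ)`; since `det γ = ±1`, `det(γ)⁻¹ = det γ`. -/
def FormEquiv (x y : Fin 4 → ℤ) : Prop :=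
  ∃ γ : Matrix (Fin 2) (Fin 2) ℤ, IsUnit γ.det ∧ y = γ.det • cubicAct γ x

/-- The discriminant of the binary cubic form with coefficients `(a,b,c,d)`. -/
def cubicDisc (x : Fin 4 → ℤ) : ℤ :=
  x 1 ^ 2 * x 2 ^ 2 + 18 * x 0 * x 1 * x 2 * x 3 - 4 * x 0 * x 2 ^ 3 - 4 * x 1 ^ 3 * x 3
    - 27 * x 0 ^ 2 * x 3 ^ 2

/-- A cubic ring, presented as a commutative, associative, unital ℤ-bilinear multiplication
on the free rank-3 ℤ-module `Fin 3 → ℤ`.  (Every cubic ring is additively isomorphic to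
`ℤ³`, so such presentations exhaust all isomorphism classes of cubic rings.) -/
structure CubicRing where
  mul : (Fin 3 → ℤ) →ₗ[ℤ] (Fin 3 → ℤ) →ₗ[ℤ] (Fin 3 → ℤ)
  one : Fin 3 → ℤ
  one_mul' : ∀ x, mul one x = x
  mul_comm' : ∀ x y, mul x y = mul y x
  mul_assoc' : ∀ x y z, mul (mul x y) z = mul x (mul y z)

/-- Isomorphism of cubic rings: a ℤ-linear additive equivalence preserving the unit and the
multiplication. -/
def CubicRing.Iso (R S : CubicRing) : Prop :=
  ∃ φ : (Fin 3 → ℤ) ≃ₗ[ℤ] (Fin 3 → ℤ),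
    φ R.one = S.one ∧ ∀ x y, φ (R.mul x y) = S.mul (φ x) (φ y)

/-- The discriminant of a cubic ring: the determinant of the matrix `(Tr(eᵢeⱼ))` of traces of
multiplication maps, with respect to the ℤ-basis `(e₀,e₁,e₂)`. -/
noncomputable def CubicRing.disc (R : CubicRing) : ℤ :=
  Matrix.det (Matrix.of fun i j : Fin 3 =>
    LinearMap.trace ℤ (Fin 3 → ℤ) (R.mul (R.mul (Pi.single i 1) (Pi.single j 1))))

/-- The multiplication of `R(f)` in coordinates. -/
def dfMulFun (f : Fin 4 → ℤ) (x y : Fin 3 → ℤ) : Fin 3 → ℤ :=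
  ![x 0 * y 0 - f 0 * f 2 * (x 1 * y 1) - f 0 * f 3 * (x 1 * y 2 + x 2 * y 1)
      - f 1 * f 3 * (x 2 * y 2),
    x 0 * y 1 + x 1 * y 0 + f 1 * (x 1 * y 1) + f 3 * (x 2 * y 2),
    x 0 * y 2 + x 2 * y 0 - f 0 * (x 1 * y 1) - f 2 * (x 2 * y 2)]

/-- The cubic ring `R(f)`. -/
def dfRing (f : Fin 4 → ℤ) : CubicRing where
  mul := LinearMap.mk₂ ℤ (dfMulFun f)
    (by intro x y z; ext i; fin_cases i <;> simp [dfMulFun] <;> ring)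
    (by intro x y z; ext i; fin_cases i <;> simp [dfMulFun] <;> ring)
    (by intro x y z; ext i; fin_cases i <;> simp [dfMulFun] <;> ring)
    (by intro x y z; ext i; fin_cases i <;> simp [dfMulFun] <;> ring)
  one := Pi.single 0 1
  one_mul' := by intro x; ext i; fin_cases i <;> simp [dfMulFun]
  mul_comm' := by intro x y; ext i; fin_cases i <;> simp [dfMulFun] <;> ring
  mul_assoc' := by intro x y z; ext i; fin_cases i <;> simp [dfMulFun] <;> ring

lemma dfRing_mul (f : Fin 4 → ℤ) (x y : Fin 3 → ℤ) : (dfRing f).mul x y = dfMulFun f x y := rfl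

lemma dfRing_one (f : Fin 4 → ℤ) : (dfRing f).one = Pi.single 0 1 := rfl

lemma vec3_decomp (x : Fin 3 → ℤ) :
    x = x 0 • (Pi.single 0 1 : Fin 3 → ℤ) + x 1 • (Pi.single 1 1 : Fin 3 → ℤ)
      + x 2 • (Pi.single 2 1 : Fin 3 → ℤ) := by
  ext i; fin_cases i <;> simp

lemma CubicRing.Iso.symm {R S : CubicRing} (h : R.Iso S) : S.Iso R := by
  obtain ⟨φ, h1, h2⟩ := h
  refine ⟨φ.symm, by rw [← h1]; simp, fun x y => ?_⟩
  apply φ.injective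
  rw [h2]; simp

lemma CubicRing.Iso.trans {R S T : CubicRing} (h : R.Iso S) (h' : S.Iso T) : R.Iso T := by
  obtain ⟨φ, h1, h2⟩ := h
  obtain ⟨ψ, h3, h4⟩ := h'
  exact ⟨φ.trans ψ, by simp [h1, h3], fun x y => by simp [h2, h4]⟩

/-- Transport of structure along a linear equivalence. -/
def CubicRing.transport (R : CubicRing) (φ : (Fin 3 → ℤ) ≃ₗ[ℤ] (Fin 3 → ℤ)) : CubicRing where
  mul := LinearMap.mk₂ ℤ (fun x y => φ (R.mul (φ.symm x) (φ.symm y)))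
    (by intros; simp only [map_add, LinearMap.add_apply])
    (by intros; simp only [map_smul, LinearMap.smul_apply])
    (by intros; simp only [map_add])
    (by intros; simp only [map_smul])
  one := φ R.one
  one_mul' := by intro x; simp [R.one_mul']
  mul_comm' := by intro x y; simp [R.mul_comm' (φ.symm x)]
  mul_assoc' := by intro x y z; simp [R.mul_assoc']

lemma CubicRing.transport_mul (R : CubicRing) (φ : (Fin 3 → ℤ) ≃ₗ[ℤ] (Fin 3 → ℤ))
    (x y : Fin 3 → ℤ) : (R.transport φ).mul x y = φ (R.mul (φ.symm x) (φ.symm y)) := rfl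

lemma CubicRing.iso_transport (R : CubicRing) (φ : (Fin 3 → ℤ) ≃ₗ[ℤ] (Fin 3 → ℤ)) :
    R.Iso (R.transport φ) :=
  ⟨φ, rfl, fun x y => by simp [transport_mul]⟩

/-- The linear equivalence with `e₀ ↦ e₀`, `e₁ ↦ (n₁, P, Q)`, `e₂ ↦ (n₂, R, S)`. -/
def shearEquiv (n₁ n₂ P Q R S : ℤ) (h : (P * S - Q * R) * (P * S - Q * R) = 1) :
    (Fin 3 → ℤ) ≃ₗ[ℤ] (Fin 3 → ℤ) where
  toFun x := ![x 0 + n₁ * x 1 + n₂ * x 2, P * x 1 + R * x 2, Q * x 1 + S * x 2]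
  map_add' := by intro x y; ext i; fin_cases i <;> simp <;> ring
  map_smul' := by intro x y; ext i; fin_cases i <;> simp <;> ring
  invFun y := ![y 0 - n₁ * ((P * S - Q * R) * (S * y 1 - R * y 2))
      - n₂ * ((P * S - Q * R) * (P * y 2 - Q * y 1)),
    (P * S - Q * R) * (S * y 1 - R * y 2), (P * S - Q * R) * (P * y 2 - Q * y 1)]
  left_inv := by
    intro x; ext i; fin_cases i
    · simp
      linear_combination (-n₁ * x 1 - n₂ * x 2) * h
    · simp
      linear_combination x 1 * h
    · simp
      linear_combination x 2 * h
  right_inv := by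
    intro x; ext i; fin_cases i
    · simp
      ring
    · simp
      linear_combination x 1 * h
    · simp
      linear_combination x 2 * h

lemma shearEquiv_apply (n₁ n₂ P Q R S : ℤ) (h : (P * S - Q * R) * (P * S - Q * R) = 1)
    (x : Fin 3 → ℤ) : shearEquiv n₁ n₂ P Q R S h x =
      ![x 0 + n₁ * x 1 + n₂ * x 2, P * x 1 + R * x 2, Q * x 1 + S * x 2] := rfl

lemma mul_hom_of_basis (f : Fin 4 → ℤ) (R : CubicRing)
    (φ : (Fin 3 → ℤ) ≃ₗ[ℤ] (Fin 3 → ℤ)) (h1 : φ (Pi.single 0 1) = R.one)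
    (h11 : φ ((dfRing f).mul (Pi.single 1 1) (Pi.single 1 1))
      = R.mul (φ (Pi.single 1 1)) (φ (Pi.single 1 1)))
    (h12 : φ ((dfRing f).mul (Pi.single 1 1) (Pi.single 2 1))
      = R.mul (φ (Pi.single 1 1)) (φ (Pi.single 2 1)))
    (h22 : φ ((dfRing f).mul (Pi.single 2 1) (Pi.single 2 1))
      = R.mul (φ (Pi.single 2 1)) (φ (Pi.single 2 1))) : (dfRing f).Iso R := by
  refine ⟨φ, h1, fun x y => ?_⟩
  have e0 : ∀ z, (dfRing f).mul (Pi.single 0 1) z = z := (dfRing f).one_mul'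
  have e0' : ∀ z, (dfRing f).mul z (Pi.single 0 1) = z := fun z => by
    rw [(dfRing f).mul_comm', e0]
  have oPr : ∀ z, R.mul z R.one = z := fun z => by rw [R.mul_comm', R.one_mul']
  have h21 : φ ((dfRing f).mul (Pi.single 2 1) (Pi.single 1 1))
      = R.mul (φ (Pi.single 2 1)) (φ (Pi.single 1 1)) := by
    rw [(dfRing f).mul_comm', h12, R.mul_comm']
  rw [vec3_decomp x, vec3_decomp y]
  simp only [map_add, map_smul, LinearMap.add_apply, LinearMap.smul_apply, h11, h12, h21, h22,
    e0, e0', h1, R.one_mul', oPr]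

lemma iso_of_formEquiv (f g : Fin 4 → ℤ) (h : FormEquiv f g) : (dfRing f).Iso (dfRing g) := by
  obtain ⟨γ, hu, rfl⟩ := h
  have h2 : γ.det * γ.det = 1 := Int.isUnit_mul_self hu
  have hd : γ.det = γ 0 0 * γ 1 1 - γ 0 1 * γ 1 0 := Matrix.det_fin_two γ
  have hact : ∀ i, (γ.det • cubicAct γ f) i = γ.det * cubicAct γ f i := fun i => by simp
  set g := γ.det • cubicAct γ f with hg
  have g0 := hact 0
  have g1 := hact 1
  have g2 := hact 2
  have g3 := hact 3
  clear_value g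
  simp only [cubicAct, Matrix.cons_val] at g0 g1 g2 g3
  rw [hd] at h2 g0 g1 g2 g3
  clear hact hg hd hu
  generalize γ 0 0 = P at *
  generalize γ 0 1 = Q at *
  generalize γ 1 0 = R at *
  generalize γ 1 1 = S at *
  apply CubicRing.Iso.symm
  refine mul_hom_of_basis g (dfRing f) (shearEquiv
    ((P * S - Q * R) * ((f 1 * P * R + f 3 * Q * S) * Q + (f 0 * P * R + f 2 * Q * S) * P))
    (-(P * S - Q * R) * ((f 1 * P * R + f 3 * Q * S) * S + (f 0 * P * R + f 2 * Q * S) * R))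
    P Q R S h2) ?_ ?_ ?_ ?_
  · rw [shearEquiv_apply, dfRing_one]; ext i; fin_cases i <;> simp
  · simp only [shearEquiv_apply, dfRing_mul]; ext i; fin_cases i <;> simp [dfMulFun, g0, g1, g2]
    · linear_combination (-f 0 * f 2 * P ^ 2 - 2 * f 0 * f 3 * P * Q - f 1 * f 3 * Q ^ 2)
        * (1 + (P * S - Q * R) ^ 2) * h2
    · linear_combination (f 1 * P ^ 2 + f 3 * Q ^ 2) * h2
    · linear_combination (-f 0 * P ^ 2 - f 2 * Q ^ 2) * h2
  · simp only [shearEquiv_apply, dfRing_mul]; ext i; fin_cases i <;> simp [dfMulFun, g0, g3]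
    · linear_combination (-f 0 * f 2 * P * R - f 0 * f 3 * (P * S + Q * R)
        - f 1 * f 3 * Q * S) * (1 + (P * S - Q * R) ^ 2) * h2
    · linear_combination (f 1 * P * R + f 3 * Q * S) * h2
    · linear_combination (-f 0 * P * R - f 2 * Q * S) * h2
  · simp only [shearEquiv_apply, dfRing_mul]; ext i; fin_cases i <;> simp [dfMulFun, g1, g2, g3]
    · linear_combination (-f 0 * f 2 * R ^ 2 - 2 * f 0 * f 3 * R * S - f 1 * f 3 * S ^ 2)
        * (1 + (P * S - Q * R) ^ 2) * h2
    · linear_combination (f 1 * R ^ 2 + f 3 * S ^ 2) * h2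
    · linear_combination (-f 0 * R ^ 2 - f 2 * S ^ 2) * h2

lemma formEquiv_of_iso (f g : Fin 4 → ℤ) (h : (dfRing f).Iso (dfRing g)) : FormEquiv f g := by
  obtain ⟨φ, h1, h2⟩ := h.symm
  rw [dfRing_one, dfRing_one] at h1
  set P := φ (Pi.single 1 1) 1 with hP
  set Q := φ (Pi.single 1 1) 2 with hQ
  set R := φ (Pi.single 2 1) 1 with hR
  set S := φ (Pi.single 2 1) 2 with hS
  have hu : (P * S - Q * R) * (P * S - Q * R) = 1 := by
    have key : ∀ x : Fin 3 → ℤ, ∀ i : Fin 3, i ≠ 0 →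
        φ x i = x 1 * φ (Pi.single 1 1) i + x 2 * φ (Pi.single 2 1) i := by
      intro x i hi
      conv_lhs => rw [vec3_decomp x]
      simp only [map_add, map_smul, h1]
      simp [hi]
    have a11 := key (φ.symm (Pi.single 1 1)) 1 (by decide)
    have a12 := key (φ.symm (Pi.single 1 1)) 2 (by decide)
    have a21 := key (φ.symm (Pi.single 2 1)) 1 (by decide)
    have a22 := key (φ.symm (Pi.single 2 1)) 2 (by decide)
    simp [← hP, ← hQ, ← hR, ← hS] at a11 a12 a21 a22
    generalize φ.symm (Pi.single 1 1) 1 = p at *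
    generalize φ.symm (Pi.single 1 1) 2 = q at *
    generalize φ.symm (Pi.single 2 1) 1 = r at *
    generalize φ.symm (Pi.single 2 1) 2 = s at *
    apply Int.isUnit_mul_self
    refine IsUnit.of_mul_eq_one (p * s - q * r) ?_
    linear_combination (-(r * Q + s * S)) * a11 + (r * P + s * R) * a12 - a22
  set n₁ := φ (Pi.single 1 1) 0 with hn1
  set n₂ := φ (Pi.single 2 1) 0 with hn2
  have E1 : φ (Pi.single 1 1) = ![n₁, P, Q] := by ext i; fin_cases i <;> simp [hn1, hP, hQ]
  have E2 : φ (Pi.single 2 1) = ![n₂, R, S] := by ext i; fin_cases i <;> simp [hn2, hR, hS]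
  have m11 : (dfRing g).mul (Pi.single 1 1) (Pi.single 1 1) = (-(g 0 * g 2)) • (Pi.single 0 1 : Fin 3 → ℤ)
            + g 1 • (Pi.single 1 1 : Fin 3 → ℤ) + (-(g 0)) • (Pi.single 2 1 : Fin 3 → ℤ) := by
    rw [dfRing_mul]; ext i; fin_cases i <;> simp [dfMulFun]
  have m12 : (dfRing g).mul (Pi.single 1 1) (Pi.single 2 1) = (-(g 0 * g 3)) • (Pi.single 0 1 : Fin 3 → ℤ) := by
    rw [dfRing_mul]; ext i; fin_cases i <;> simp [dfMulFun]
  have m22 : (dfRing g).mul (Pi.single 2 1) (Pi.single 2 1) = (-(g 1 * g 3)) • (Pi.single 0 1 : Fin 3 → ℤ)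
            + g 3 • (Pi.single 1 1 : Fin 3 → ℤ) + (-(g 2)) • (Pi.single 2 1 : Fin 3 → ℤ) := by
    rw [dfRing_mul]; ext i; fin_cases i <;> simp [dfMulFun]
  have p11 := h2 (Pi.single 1 1) (Pi.single 1 1)
  have p12 := h2 (Pi.single 1 1) (Pi.single 2 1)
  have p22 := h2 (Pi.single 2 1) (Pi.single 2 1)
  rw [m11, dfRing_mul] at p11
  rw [m12, dfRing_mul] at p12
  rw [m22, dfRing_mul] at p22
  simp only [map_add, map_smul, h1, E1, E2] at p11 p12 p22
  have q1 := congrFun p11 1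
  have q2 := congrFun p11 2
  have q3 := congrFun p12 1
  have q4 := congrFun p12 2
  have q5 := congrFun p22 1
  have q6 := congrFun p22 2
  clear p11 p12 p22 m11 m12 m22
  simp only [Pi.add_apply, Pi.smul_apply, smul_eq_mul] at q1 q2 q3 q4 q5 q6
  simp [dfMulFun] at q1 q2 q3 q4 q5 q6
  clear_value P Q R S n₁ n₂
  have hdet : (!![P, Q; R, S] : Matrix (Fin 2) (Fin 2) ℤ).det = P * S - Q * R := by
    simp [Matrix.det_fin_two]
  refine ⟨!![P, Q; R, S], ?_, ?_⟩
  · rw [hdet]; exact IsUnit.of_mul_eq_one _ hu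
  · rw [hdet]
    ext i; fin_cases i <;> simp [cubicAct]
    · linear_combination (P * S - Q * R) * (Q * q1 - P * q2) - g 0 * hu
    · linear_combination (P * S - Q * R) * (S * q1 - R * q2 + 2 * (Q * q3 - P * q4)) - g 1 * hu
    · linear_combination (P * S - Q * R) * (Q * q5 - P * q6 + 2 * (S * q3 - R * q4)) - g 2 * hu
    · linear_combination (P * S - Q * R) * (S * q5 - R * q6) - g 3 * hu

lemma exists_primitive (R : CubicRing) : ∃ x y z : ℤ,
    x * R.one 0 + y * R.one 1 + z * R.one 2 = 1 := by
  set a := R.one 0 with ha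
  set b := R.one 1 with hb
  set c := R.one 2 with hc
  have e1 := Int.gcd_eq_gcd_ab a b
  have e2 := Int.gcd_eq_gcd_ab (Int.gcd a b) c
  set d : ℤ := (Int.gcd (Int.gcd a b) c : ℤ) with hd
  have daPr : d ∣ (Int.gcd a b : ℤ) := Int.gcd_dvd_left _ _
  have dc : d ∣ c := Int.gcd_dvd_right _ _
  obtain ⟨aPr, haPr⟩ := daPr.trans (Int.gcd_dvd_left a b)
  obtain ⟨bPr, hbPr⟩ := daPr.trans (Int.gcd_dvd_right a b)
  obtain ⟨cPr, hcPr⟩ := dc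
  have ho : R.one = d • ![aPr, bPr, cPr] := by
    ext i; fin_cases i
    · simp [← ha, ← haPr]
    · simp [← hb, ← hbPr]
    · simp [← hc, ← hcPr]
  have h1 := congrFun (R.one_mul' (Pi.single 1 1)) 1
  rw [ho, map_smul, LinearMap.smul_apply, Pi.smul_apply, Pi.single_eq_same, smul_eq_mul] at h1
  generalize R.mul ![aPr, bPr, cPr] (Pi.single 1 1) 1 = k at h1
  rw [e1] at e2
  refine ⟨k * (Int.gcdA a b * Int.gcdA (Int.gcd a b) c),
    k * (Int.gcdB a b * Int.gcdA (Int.gcd a b) c), k * Int.gcdB (Int.gcd a b) c, ?_⟩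
  rw [← e1] at e2
  linear_combination h1 - k * e2 - k * Int.gcdA (Int.gcd a b) c * e1

lemma exists_unital_equiv (a b c : ℤ) (h : ∃ x y z : ℤ, x * a + y * b + z * c = 1) :
    ∃ φ : (Fin 3 → ℤ) ≃ₗ[ℤ] (Fin 3 → ℤ), φ ![a, b, c] = Pi.single 0 1 := by
  obtain ⟨g, aPr, bPr, s, t, ha, hb, hst⟩ :
      ∃ g aPr bPr s t : ℤ, a = g * aPr ∧ b = g * bPr ∧ s * aPr + t * bPr = 1 := by
    by_cases hg : (Int.gcd a b : ℤ) = 0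
    · have h0 : Int.gcd a b = 0 := by exact_mod_cast hg
      rw [Int.gcd_eq_zero_iff] at h0
      exact ⟨0, 1, 0, 1, 0, by simp [h0.1], by simp [h0.2], by norm_num⟩
    · obtain ⟨aPr, ha⟩ := Int.gcd_dvd_left a b
      obtain ⟨bPr, hb⟩ := Int.gcd_dvd_right a b
      refine ⟨Int.gcd a b, aPr, bPr, Int.gcdA a b, Int.gcdB a b, ha, hb, ?_⟩
      apply mul_left_cancel₀ hg
      have e := Int.gcd_eq_gcd_ab a b
      linear_combination -Int.gcdA a b * ha - Int.gcdB a b * hb - e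
  obtain ⟨x₀, y₀, y, h⟩ := h
  obtain ⟨x, hx⟩ : ∃ x : ℤ, x * g + y * c = 1 :=
    ⟨x₀ * aPr + y₀ * bPr, by rw [← h, ha, hb]; ring⟩
  let M : Matrix (Fin 3) (Fin 3) ℤ := !![a, -t, -y * aPr; b, s, -y * bPr; c, 0, x]
  have hM : M.det = 1 := by
    simp [M, Matrix.det_fin_three, ha, hb]
    linear_combination hx + (g * x + c * y) * hst
  have hi : Invertible M := Matrix.invertibleOfIsUnitDet M (by rw [hM]; exact isUnit_one)
  refine ⟨(Matrix.toLinearEquiv' M hi).symm, ?_⟩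
  rw [LinearEquiv.symm_apply_eq]
  change ![a, b, c] = Matrix.toLin' M (Pi.single 0 1)
  ext i; fin_cases i <;> simp [M]

lemma iso_of_normalized (R : CubicRing) (h1 : R.one = Pi.single 0 1) (n : ℤ)
    (hn : R.mul (Pi.single 1 1) (Pi.single 2 1) = n • (Pi.single 0 1 : Fin 3 → ℤ)) :
    ∃ f, (dfRing f).Iso R := by
  have o : ∀ z, R.mul (Pi.single 0 1) z = z := fun z => by rw [← h1, R.one_mul']
  have oPr : ∀ z, R.mul z (Pi.single 0 1) = z := fun z => by rw [R.mul_comm', o]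
  have A := R.mul_assoc' (Pi.single 1 1) (Pi.single 1 1) (Pi.single 2 1)
  have B := R.mul_assoc' (Pi.single 1 1) (Pi.single 2 1) (Pi.single 2 1)
  set W := R.mul (Pi.single 1 1) (Pi.single 1 1) with hW
  set T := R.mul (Pi.single 2 1) (Pi.single 2 1) with hT
  rw [hn, vec3_decomp W] at A
  rw [hn, vec3_decomp T] at B
  simp only [map_add, map_smul, LinearMap.add_apply, LinearMap.smul_apply, hn, o, oPr, ← hW,
    ← hT] at A B
  have A1 := congrFun A 1
  have A2 := congrFun A 2
  have B1 := congrFun B 1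
  simp at A1 A2 B1
  refine ⟨![-W 2, W 1, -T 2, T 1], mul_hom_of_basis _ R (LinearEquiv.refl ℤ _) h1.symm ?_ ?_ ?_⟩
  · simp only [LinearEquiv.refl_apply, ← hW, dfRing_mul]
    ext i; fin_cases i <;> simp [dfMulFun]
    linarith
  · simp only [LinearEquiv.refl_apply, hn, dfRing_mul]
    ext i; fin_cases i <;> simp [dfMulFun]
    linarith
  · simp only [LinearEquiv.refl_apply, ← hT, dfRing_mul]
    ext i; fin_cases i <;> simp [dfMulFun]
    linarith

lemma exists_form (R : CubicRing) : ∃ f, (dfRing f).Iso R := by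
  obtain ⟨φ, hφ⟩ := exists_unital_equiv _ _ _ (exists_primitive R)
  have hv : ![R.one 0, R.one 1, R.one 2] = R.one := by ext i; fin_cases i <;> simp
  rw [hv] at hφ
  have i1 := R.iso_transport φ
  have o1 : (R.transport φ).one = Pi.single 0 1 := hφ
  generalize R.transport φ = R₁ at i1 o1
  have o : ∀ z, R₁.mul (Pi.single 0 1) z = z := fun z => by rw [← o1, R₁.one_mul']
  have oPr : ∀ z, R₁.mul z (Pi.single 0 1) = z := fun z => by rw [R₁.mul_comm', o]
  set V := R₁.mul (Pi.single 1 1) (Pi.single 2 1) with hV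
  let ψ := shearEquiv (-V 2) (-V 1) 1 0 0 1 (by norm_num)
  have p0 : ψ (Pi.single 0 1) = Pi.single 0 1 := by
    simp only [ψ, shearEquiv_apply]; ext i; fin_cases i <;> simp
  have p1 : ψ (Pi.single 1 1)
      = (-V 2) • (Pi.single 0 1 : Fin 3 → ℤ) + (Pi.single 1 1 : Fin 3 → ℤ) := by
    simp only [ψ, shearEquiv_apply]; ext i; fin_cases i <;> simp
  have p2 : ψ (Pi.single 2 1)
      = (-V 1) • (Pi.single 0 1 : Fin 3 → ℤ) + (Pi.single 2 1 : Fin 3 → ℤ) := by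
    simp only [ψ, shearEquiv_apply]; ext i; fin_cases i <;> simp
  clear_value ψ
  have i2 := R₁.iso_transport ψ.symm
  obtain ⟨f, hf⟩ := iso_of_normalized (R₁.transport ψ.symm)
    (by change ψ.symm R₁.one = _; rw [o1, LinearEquiv.symm_apply_eq, p0]) (V 0 + V 1 * V 2)
    (by
      rw [CubicRing.transport_mul, LinearEquiv.symm_apply_eq, LinearEquiv.symm_symm, p1, p2,
        map_smul, p0]
      simp only [map_add, map_smul, LinearMap.add_apply, LinearMap.smul_apply, o, oPr, ← hV]
      ext i; fin_cases i <;> simp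
      ring)
  exact ⟨f, (hf.trans i2.symm).trans i1.symm⟩

lemma dfRing_disc (f : Fin 4 → ℤ) : (dfRing f).disc = cubicDisc f := by
  unfold CubicRing.disc
  have ht : ∀ x, LinearMap.trace ℤ (Fin 3 → ℤ) ((dfRing f).mul x)
      = 3 * x 0 + f 1 * x 1 - f 2 * x 2 := by
    intro x
    rw [LinearMap.trace_eq_matrix_trace ℤ (Pi.basisFun ℤ (Fin 3)), Matrix.trace_fin_three]
    simp [dfRing_mul, dfMulFun]
    ring
  simp only [ht, Matrix.det_fin_three, dfRing_mul]
  simp [dfMulFun, cubicDisc]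
  ring

/-- Delone–Faddeev / Gan–Gross–Savin: the map `f ↦ R(f)` — where `R(f)` has basis
`⟨1, ω, θ⟩ = (e₀, e₁, e₂)` and multiplication `ωθ = −ad`, `ω² = −ac + bω − aθ`,
`θ² = −bd + dω − cθ` — induces a bijection between `GL₂(ℤ)`-equivalence classes of integral
binary cubic forms and isomorphism classes of cubic rings, and `disc R(f) = D(f)`. -/
theorem delone_faddeev_gan_gross_savin :
    ∃ Φ : (Fin 4 → ℤ) → CubicRing,
      (∀ f : Fin 4 → ℤ,
        (Φ f).one = Pi.single 0 1 ∧
        (Φ f).mul (Pi.single 1 1) (Pi.single 2 1)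
          = (-(f 0 * f 3)) • (Pi.single 0 1 : Fin 3 → ℤ) ∧
        (Φ f).mul (Pi.single 1 1) (Pi.single 1 1)
          = (-(f 0 * f 2)) • (Pi.single 0 1 : Fin 3 → ℤ)
            + f 1 • (Pi.single 1 1 : Fin 3 → ℤ) + (-(f 0)) • (Pi.single 2 1 : Fin 3 → ℤ) ∧
        (Φ f).mul (Pi.single 2 1) (Pi.single 2 1)
          = (-(f 1 * f 3)) • (Pi.single 0 1 : Fin 3 → ℤ)
            + f 3 • (Pi.single 1 1 : Fin 3 → ℤ) + (-(f 2)) • (Pi.single 2 1 : Fin 3 → ℤ)) ∧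
      (∀ f g : Fin 4 → ℤ, FormEquiv f g ↔ (Φ f).Iso (Φ g)) ∧
      (∀ R : CubicRing, ∃ f : Fin 4 → ℤ, (Φ f).Iso R) ∧
      (∀ f : Fin 4 → ℤ, (Φ f).disc = cubicDisc f) := by
  refine ⟨dfRing, fun f => ⟨rfl, ?_, ?_, ?_⟩,
    fun f g => ⟨iso_of_formEquiv f g, formEquiv_of_iso f g⟩, exists_form, dfRing_disc⟩ <;>
  · rw [dfRing_mul]; ext i; fin_cases i <;> simp [dfMulFun]
end

section
/- For every nonzero integer m, the set of SL₂(ℤ)-orbits on the set {x ∈ ℤ⁴ : D(x) = m} of integral binary cubic forms of discriminant m (under the twisted action) is finite; that is, the class number h(m) is finite. -/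
/-- Reduction of real positive definite binary quadratic forms. -/
lemma quad_reduce (A B C : ℝ) (hA : 0 < A) (hD : B ^ 2 < 4 * A * C) :
    ∃ a b c d : ℤ, a * d - b * c = 1 ∧
      |2 * A * a * c + B * (a * d + b * c) + 2 * C * b * d| ≤ A * a ^ 2 + B * a * b + C * b ^ 2 ∧
      A * a ^ 2 + B * a * b + C * b ^ 2 ≤ A * c ^ 2 + B * c * d + C * d ^ 2 := by
  have ht : 0 < Real.sqrt (4 * A * C - B ^ 2) := Real.sqrt_pos.mpr (by linarith)
  have ht2 : Real.sqrt (4 * A * C - B ^ 2) ^ 2 = 4 * A * C - B ^ 2 :=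
    Real.sq_sqrt (by linarith)
  set t := Real.sqrt (4 * A * C - B ^ 2) with htdef
  let z : UpperHalfPlane := ⟨⟨B / (2 * A), t / (2 * A)⟩, by
    show 0 < t / (2 * A)
    positivity⟩
  have hzre : (z : ℂ).re = B / (2 * A) := rfl
  have hzim : (z : ℂ).im = t / (2 * A) := rfl
  obtain ⟨g, hg⟩ := ModularGroup.exists_smul_mem_fd z
  obtain ⟨h1, h2⟩ := hg
  have hdet := g.det_coe
  rw [Matrix.det_fin_two] at hdet
  have hw : ((g • z : UpperHalfPlane) : ℂ) * ((g 1 0 : ℂ) * z + (g 1 1 : ℂ))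
      = (g 0 0 : ℂ) * z + (g 0 1 : ℂ) := by
    rw [UpperHalfPlane.specialLinearGroup_apply]
    have hne : ((g 1 0 : ℂ) * z + (g 1 1 : ℂ)) ≠ 0 := by
      have := UpperHalfPlane.denom_ne_zero (g : Matrix.GeneralLinearGroup (Fin 2) ℝ) z
      simpa [UpperHalfPlane.denom] using this
    simp only [algebraMap_int_eq, eq_intCast, Complex.ofReal_intCast]
    exact div_mul_cancel₀ _ hne
  have h2' : |((g • z : UpperHalfPlane) : ℂ).re| ≤ 1 / 2 := h2
  have h1' : 1 ≤ ((g • z : UpperHalfPlane) : ℂ).re * ((g • z : UpperHalfPlane) : ℂ).re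
      + ((g • z : UpperHalfPlane) : ℂ).im * ((g • z : UpperHalfPlane) : ℂ).im := by
    simpa [Complex.normSq_apply] using h1
  generalize ((g • z : UpperHalfPlane) : ℂ) = w at hw h1' h2'
  have hre := congrArg Complex.re hw
  have him := congrArg Complex.im hw
  simp only [Complex.mul_re, Complex.mul_im, Complex.add_re, Complex.add_im, Complex.intCast_re,
    Complex.intCast_im, hzre, hzim] at hre him
  clear_value z
  clear_value t
  generalize g 0 0 = α at *
  generalize g 0 1 = β at *
  generalize g 1 0 = γ at *
  generalize g 1 1 = δ at *
  refine ⟨δ, γ, β, α, by linarith, ?_, ?_⟩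
  all_goals
    set s := B / (2 * A) with hs
    set r := t / (2 * A) with hr
    have hB : B = 2 * A * s := by rw [hs]; field_simp
    have hT : t = 2 * A * r := by rw [hr]; field_simp
    have hC : C = A * (s ^ 2 + r ^ 2) := by
      have h4 : 4 * A * C = 4 * A * (A * (s ^ 2 + r ^ 2)) := by
        rw [hT, hB] at ht2
        linarith
      exact mul_left_cancel₀ (by positivity) h4
    clear_value s r
    subst hC
    subst hB
    have hre' : (α : ℝ) * s + β = w.re * (γ * s + δ) - w.im * (γ * r) := by linarith
    have him' : (α : ℝ) * r = w.re * (γ * r) + w.im * (γ * s + δ) := by linarith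
    have hA' : A * (δ : ℝ) ^ 2 + 2 * A * s * δ * γ + A * (s ^ 2 + r ^ 2) * (γ : ℝ) ^ 2
        = A * ((γ * s + δ) ^ 2 + (γ * r) ^ 2) := by ring
    have hN : 0 ≤ A * ((γ * s + δ) ^ 2 + (γ * r) ^ 2) := by positivity
  · rw [hA']
    have hB' : 2 * A * (δ : ℝ) * β + 2 * A * s * (δ * α + γ * β) + 2 * (A * (s ^ 2 + r ^ 2)) * γ * α
        = 2 * w.re * (A * ((γ * s + δ) ^ 2 + (γ * r) ^ 2)) := by
      have : 2 * A * (δ : ℝ) * β + 2 * A * s * (δ * α + γ * β)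
          + 2 * (A * (s ^ 2 + r ^ 2)) * γ * α
        = 2 * A * ((α * s + β) * (γ * s + δ) + (α * r) * (γ * r)) := by ring
      rw [this, hre', him']
      ring
    rw [hB', abs_mul, abs_of_nonneg hN, abs_mul, abs_two]
    nlinarith
  · rw [hA']
    have hC' : A * (β : ℝ) ^ 2 + 2 * A * s * β * α + A * (s ^ 2 + r ^ 2) * (α : ℝ) ^ 2
        = (w.re * w.re + w.im * w.im) * (A * ((γ * s + δ) ^ 2 + (γ * r) ^ 2)) := by
      have : A * (β : ℝ) ^ 2 + 2 * A * s * β * α + A * (s ^ 2 + r ^ 2) * (α : ℝ) ^ 2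
        = A * ((α * s + β) ^ 2 + (α * r) ^ 2) := by ring
      rw [this, hre', him']
      ring
    rw [hC']
    nlinarith

lemma cubicAct_mul (g h : Matrix (Fin 2) (Fin 2) ℤ) (x : Fin 4 → ℤ) :
    cubicAct g (cubicAct h x) = cubicAct (g * h) x := by
  funext i
  fin_cases i <;> simp [cubicAct, Matrix.mul_apply, Fin.sum_univ_two] <;> ring

lemma cubicAct_one (x : Fin 4 → ℤ) : cubicAct 1 x = x := by
  funext i
  fin_cases i <;> simp [cubicAct]

lemma cubicDisc_act (g : Matrix (Fin 2) (Fin 2) ℤ) (hg : g.det = 1) (x : Fin 4 → ℤ) :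
    cubicDisc (cubicAct g x) = cubicDisc x := by
  have h : cubicDisc (cubicAct g x) = (g 0 0 * g 1 1 - g 0 1 * g 1 0) ^ 6 * cubicDisc x := by
    simp [cubicAct, cubicDisc]
    ring
  rw [h, ← Matrix.det_fin_two, hg]
  ring

/-- Every coefficient is bounded by `N`. -/
def CoeffBdd (N : ℤ) (y : Fin 4 → ℤ) : Prop := ∀ i, |y i| ≤ N

lemma bdd_of_zero (m : ℤ) (hm : m ≠ 0) (x : Fin 4 → ℤ) (hx : cubicDisc x = m) (h0 : x 0 = 0) :
    ∃ γ : Matrix (Fin 2) (Fin 2) ℤ, γ.det = 1 ∧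
      CoeffBdd (8 * |m| ^ 2 + 8 * |m|) (cubicAct γ x) := by
  have hb0 : x 1 ≠ 0 := by
    rintro h
    apply hm
    rw [← hx]
    simp [cubicDisc, h0, h]
  have hM : 1 ≤ |m| := Int.one_le_abs hm
  obtain ⟨k, hk⟩ : ∃ k : ℤ, |x 2 + 2 * x 1 * k| ≤ 2 * |x 1| := by
    refine ⟨-(x 2 / (2 * x 1)), ?_⟩
    have h1 := Int.emod_add_mul_ediv (x 2) (2 * x 1)
    have h2 := Int.emod_nonneg (x 2) (b := 2 * x 1) (by omega)
    have h3 := Int.emod_lt_abs (x 2) (b := 2 * x 1) (by omega)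
    rw [abs_mul, abs_two] at h3
    have h4 : x 2 + 2 * x 1 * -(x 2 / (2 * x 1)) = x 2 % (2 * x 1) := by linarith
    rw [h4, abs_of_nonneg h2]
    exact h3.le
  have hdet : (!![1, 0; k, 1] : Matrix (Fin 2) (Fin 2) ℤ).det = 1 := by
    simp [Matrix.det_fin_two]
  refine ⟨!![1, 0; k, 1], hdet, ?_⟩
  have hD := cubicDisc_act _ hdet x
  rw [hx] at hD
  have e0 : cubicAct !![1, 0; k, 1] x 0 = 0 := by simp [cubicAct, h0]
  have e1 : cubicAct !![1, 0; k, 1] x 1 = x 1 := by simp [cubicAct, h0]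
  have e2 : cubicAct !![1, 0; k, 1] x 2 = x 2 + 2 * x 1 * k := by
    simp [cubicAct, h0]; ring
  rw [← e2, ← e1] at hk
  rw [← e1] at hb0
  generalize cubicAct !![1, 0; k, 1] x = y at *
  clear hx h0 e1 e2
  have hD' : y 1 * (y 1 * (y 2 ^ 2 - 4 * y 1 * y 3)) = m := by
    rw [← hD]; simp [cubicDisc, e0]; ring
  have hE : |y 1| * (|y 1| * |y 2 ^ 2 - 4 * y 1 * y 3|) = |m| := by
    rw [← abs_mul, ← abs_mul, hD']
  have hb1 : 1 ≤ |y 1| := Int.one_le_abs hb0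
  have hq : 1 ≤ |y 2 ^ 2 - 4 * y 1 * y 3| := by
    apply Int.one_le_abs
    rintro h
    rw [h] at hD'
    apply hm
    rw [← hD']; ring
  have hbM : |y 1| ≤ |m| := by
    rw [← hE]; nlinarith [mul_le_mul hb1 hq (by norm_num) (by positivity)]
  have hqM : |y 2 ^ 2 - 4 * y 1 * y 3| ≤ |m| := by
    rw [← hE]
    have : |y 2 ^ 2 - 4 * y 1 * y 3| ≤ |y 1| * |y 2 ^ 2 - 4 * y 1 * y 3| := by nlinarith
    nlinarith
  have hc : |y 2| ≤ 2 * |m| := by linarith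
  have hc2 : y 2 ^ 2 ≤ 4 * |m| ^ 2 := by
    rw [← sq_abs]; nlinarith [abs_nonneg (y 2)]
  have hbd : 4 * |y 1 * y 3| ≤ 4 * |m| ^ 2 + |m| := by
    have : |4 * (y 1 * y 3)| ≤ 4 * |m| ^ 2 + |m| := by
      rw [abs_le] at hqM ⊢
      constructor <;> nlinarith [sq_nonneg (y 2)]
    rwa [abs_mul, abs_of_nonneg (by norm_num : (0 : ℤ) ≤ 4)] at this
  have hd : |y 3| ≤ |y 1 * y 3| := by
    rw [abs_mul]; nlinarith [abs_nonneg (y 3)]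
  intro i
  fin_cases i
  · simp [e0]; positivity
  · show |y 1| ≤ _
    nlinarith
  · show |y 2| ≤ _
    nlinarith
  · show |y 3| ≤ _
    nlinarith [abs_nonneg (y 3)]

lemma abs_le_of_sq (n k : ℤ) (hk : 0 ≤ k) (h : n ^ 2 ≤ k ^ 2) : |n| ≤ k :=
  abs_le_of_sq_le_sq h hk

lemma bdd_of_pos (m : ℤ) (hm : 0 < m) (x : Fin 4 → ℤ) (hx : cubicDisc x = m) :
    ∃ γ : Matrix (Fin 2) (Fin 2) ℤ, γ.det = 1 ∧
      CoeffBdd (8 * |m| ^ 2 + 8 * |m|) (cubicAct γ x) := by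
  -- the syzygy, first in the leading coefficient
  have syz : ∀ a b c d : ℤ, 27 * (b ^ 2 * c ^ 2 + 18 * a * b * c * d - 4 * a * c ^ 3
      - 4 * b ^ 3 * d - 27 * a ^ 2 * d ^ 2) * a ^ 2 ≤ 4 * (b ^ 2 - 3 * a * c) ^ 3 := by
    intro a b c d
    nlinarith [sq_nonneg (2 * b ^ 3 - 9 * a * b * c + 27 * a ^ 2 * d)]
  have hxD := hx
  simp only [cubicDisc] at hxD
  have hdisc : 4 * (x 1 ^ 2 - 3 * x 0 * x 2) * (x 2 ^ 2 - 3 * x 1 * x 3)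
      - (x 1 * x 2 - 9 * x 0 * x 3) ^ 2 = 3 * m := by rw [← hxD]; ring
  have hApos : 0 < x 1 ^ 2 - 3 * x 0 * x 2 := by
    have h1 := syz (x 0) (x 1) (x 2) (x 3)
    rw [hxD] at h1
    by_contra hcon
    push Not at hcon
    have h2 : x 1 ^ 2 - 3 * x 0 * x 2 ≠ 0 := by
      intro h
      rw [h] at hdisc
      nlinarith [sq_nonneg (x 1 * x 2 - 9 * x 0 * x 3)]
    have h3 : x 1 ^ 2 - 3 * x 0 * x 2 < 0 := lt_of_le_of_ne hcon h2
    have h4 : (x 1 ^ 2 - 3 * x 0 * x 2) ^ 3 < 0 := Odd.pow_neg (by decide) h3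
    have h5 : 0 ≤ 27 * m * x 0 ^ 2 := by positivity
    linarith
  obtain ⟨a, b, c, d, hdet, hB, hC⟩ := quad_reduce ((x 1 ^ 2 - 3 * x 0 * x 2 : ℤ) : ℝ)
    ((x 1 * x 2 - 9 * x 0 * x 3 : ℤ) : ℝ) ((x 2 ^ 2 - 3 * x 1 * x 3 : ℤ) : ℝ)
    (by exact_mod_cast hApos) (by
      have : (x 1 * x 2 - 9 * x 0 * x 3) ^ 2
        < 4 * (x 1 ^ 2 - 3 * x 0 * x 2) * (x 2 ^ 2 - 3 * x 1 * x 3) := by linarith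
      exact_mod_cast this)
  have hdet' : (!![a, b; c, d] : Matrix (Fin 2) (Fin 2) ℤ).det = 1 := by
    rw [Matrix.det_fin_two_of]; exact hdet
  refine ⟨!![a, b; c, d], hdet', ?_⟩
  have hyD := cubicDisc_act _ hdet' x
  rw [hx] at hyD
  norm_cast at hB hC
  have hsq : (a * d - b * c) ^ 2 = 1 := by rw [hdet]; norm_num
  set y := cubicAct !![a, b; c, d] x with hy
  have E1 : y 1 ^ 2 - 3 * y 0 * y 2 = (a * d - b * c) ^ 2 * ((x 1 ^ 2 - 3 * x 0 * x 2) * a ^ 2 + (x 1 * x 2 - 9 * x 0 * x 3) * a * b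
      + (x 2 ^ 2 - 3 * x 1 * x 3) * b ^ 2) := by
    simp [hy, cubicAct]; ring
  have E2 : y 1 * y 2 - 9 * y 0 * y 3 = (a * d - b * c) ^ 2 * (2 * (x 1 ^ 2 - 3 * x 0 * x 2) * a * c
      + (x 1 * x 2 - 9 * x 0 * x 3) * (a * d + b * c)
      + 2 * (x 2 ^ 2 - 3 * x 1 * x 3) * b * d) := by
    simp [hy, cubicAct]; ring
  have E3 : y 2 ^ 2 - 3 * y 1 * y 3 = (a * d - b * c) ^ 2 * ((x 1 ^ 2 - 3 * x 0 * x 2) * c ^ 2 + (x 1 * x 2 - 9 * x 0 * x 3) * c * d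
      + (x 2 ^ 2 - 3 * x 1 * x 3) * d ^ 2) := by
    simp [hy, cubicAct]; ring
  rw [hsq, one_mul] at E1 E2 E3
  rw [← E1, ← E2] at hB
  rw [← E1, ← E3] at hC
  clear E1 E2 E3 hdisc hApos hxD hx
  clear_value y
  simp only [cubicDisc] at hyD
  have hdisc : 4 * (y 1 ^ 2 - 3 * y 0 * y 2) * (y 2 ^ 2 - 3 * y 1 * y 3)
      - (y 1 * y 2 - 9 * y 0 * y 3) ^ 2 = 3 * m := by rw [← hyD]; ring
  have s1 := syz (y 0) (y 1) (y 2) (y 3)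
  rw [hyD] at s1
  have s2 := syz (y 3) (y 2) (y 1) (y 0)
  rw [show y 2 ^ 2 * y 1 ^ 2 + 18 * y 3 * y 2 * y 1 * y 0 - 4 * y 3 * y 1 ^ 3 - 4 * y 2 ^ 3 * y 0
    - 27 * y 3 ^ 2 * y 0 ^ 2 = m by rw [← hyD]; ring] at s2
  have s3 := syz (y 0 + y 1 + y 2 + y 3) (y 1 + 2 * y 2 + 3 * y 3) (y 2 + 3 * y 3) (y 3)
  rw [show (y 1 + 2 * y 2 + 3 * y 3) ^ 2 * (y 2 + 3 * y 3) ^ 2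
    + 18 * (y 0 + y 1 + y 2 + y 3) * (y 1 + 2 * y 2 + 3 * y 3) * (y 2 + 3 * y 3) * y 3
    - 4 * (y 0 + y 1 + y 2 + y 3) * (y 2 + 3 * y 3) ^ 3 - 4 * (y 1 + 2 * y 2 + 3 * y 3) ^ 3 * y 3
    - 27 * (y 0 + y 1 + y 2 + y 3) ^ 2 * y 3 ^ 2 = m by rw [← hyD]; ring] at s3
  have s4 := syz (y 0 - y 1 + y 2 - y 3) (y 1 - 2 * y 2 + 3 * y 3) (y 2 - 3 * y 3) (y 3)
  rw [show (y 1 - 2 * y 2 + 3 * y 3) ^ 2 * (y 2 - 3 * y 3) ^ 2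
    + 18 * (y 0 - y 1 + y 2 - y 3) * (y 1 - 2 * y 2 + 3 * y 3) * (y 2 - 3 * y 3) * y 3
    - 4 * (y 0 - y 1 + y 2 - y 3) * (y 2 - 3 * y 3) ^ 3 - 4 * (y 1 - 2 * y 2 + 3 * y 3) ^ 3 * y 3
    - 27 * (y 0 - y 1 + y 2 - y 3) ^ 2 * y 3 ^ 2 = m by rw [← hyD]; ring] at s4
  rw [show (y 2 ^ 2 - 3 * y 3 * y 1) = y 2 ^ 2 - 3 * y 1 * y 3 by ring] at s2
  rw [show (y 1 + 2 * y 2 + 3 * y 3) ^ 2 - 3 * (y 0 + y 1 + y 2 + y 3) * (y 2 + 3 * y 3)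
    = (y 1 ^ 2 - 3 * y 0 * y 2) + (y 1 * y 2 - 9 * y 0 * y 3) + (y 2 ^ 2 - 3 * y 1 * y 3)
    by ring] at s3
  rw [show (y 1 - 2 * y 2 + 3 * y 3) ^ 2 - 3 * (y 0 - y 1 + y 2 - y 3) * (y 2 - 3 * y 3)
    = (y 1 ^ 2 - 3 * y 0 * y 2) - (y 1 * y 2 - 9 * y 0 * y 3) + (y 2 ^ 2 - 3 * y 1 * y 3)
    by ring] at s4
  generalize (y 1 ^ 2 - 3 * y 0 * y 2) = A at *
  generalize (y 1 * y 2 - 9 * y 0 * y 3) = B at *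
  generalize (y 2 ^ 2 - 3 * y 1 * y 3) = C at *
  have hA0 : 0 ≤ A := le_trans (abs_nonneg B) hB
  have hA1 : 1 ≤ A := by
    rcases hA0.eq_or_lt with h | h
    · rw [← h] at hdisc
      nlinarith [sq_nonneg B]
    · exact h
  have hBB : B ^ 2 ≤ A * C := by
    rw [← sq_abs]; nlinarith [abs_nonneg B]
  have hCm : C ≤ m := by nlinarith
  have hB' := abs_le.mp hB
  have key : ∀ n k : ℤ, 27 * m * n ^ 2 ≤ 4 * k ^ 3 → k ≤ 3 * m → |n| ≤ 2 * m := by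
    intro n k h1 h2
    apply abs_le_of_sq _ _ (by linarith)
    have h3 : k ^ 3 ≤ (3 * m) ^ 3 := Odd.pow_le_pow (by decide) |>.mpr h2
    have h4 : m * n ^ 2 ≤ m * (2 * m) ^ 2 := by nlinarith
    exact le_of_mul_le_mul_left h4 hm
  have k1 := abs_le.mp (key _ _ s1 (by linarith))
  have k2 := abs_le.mp (key _ _ s2 (by linarith))
  have k3 := abs_le.mp (key _ _ s3 (by linarith))
  have k4 := abs_le.mp (key _ _ s4 (by linarith))
  have hN : 4 * m ≤ 8 * |m| ^ 2 + 8 * |m| := by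
    rw [abs_of_pos hm]; nlinarith
  intro i
  refine le_trans ?_ hN
  rw [abs_le]
  fin_cases i
  · show -(4 * m) ≤ y 0 ∧ y 0 ≤ 4 * m
    constructor <;> linarith
  · show -(4 * m) ≤ y 1 ∧ y 1 ≤ 4 * m
    constructor <;> linarith
  · show -(4 * m) ≤ y 2 ∧ y 2 ≤ 4 * m
    constructor <;> linarith
  · show -(4 * m) ≤ y 3 ∧ y 3 ≤ 4 * m
    constructor <;> linarith

lemma exists_real_root_pos (a b c d : ℝ) (ha : 1 ≤ a) :
    ∃ θ : ℝ, a * θ ^ 3 + b * θ ^ 2 + c * θ + d = 0 := by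
  set T := 1 + |b| + |c| + |d| with hT
  have hb := abs_nonneg b
  have hc := abs_nonneg c
  have hd := abs_nonneg d
  have hT1 : 1 ≤ T := by linarith
  have hT2 : T ≤ T ^ 2 := by nlinarith
  have bb := abs_le.mp (le_refl |b|)
  have bc := abs_le.mp (le_refl |c|)
  have bd := abs_le.mp (le_refl |d|)
  have h3 : T ^ 3 = T ^ 2 + |b| * T ^ 2 + |c| * T ^ 2 + |d| * T ^ 2 := by
    rw [show T ^ 3 = T * T ^ 2 by ring]; nth_rewrite 1 [hT]; ring
  have h3a : T ^ 3 ≤ a * T ^ 3 := by nlinarith [pow_pos (by linarith : 0 < T) 3]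
  have hb1 : |b * T ^ 2| ≤ |b| * T ^ 2 := by rw [abs_mul, abs_of_nonneg (sq_nonneg T)]
  have hc1 : |c * T| ≤ |c| * T ^ 2 := by
    rw [abs_mul, abs_of_nonneg (by linarith : 0 ≤ T)]; gcongr
  have hd1 : |d| ≤ |d| * T ^ 2 := by nlinarith
  have hb2 := abs_le.mp hb1
  have hc2 := abs_le.mp hc1
  have hd2 := abs_le.mp hd1
  have hcont : ContinuousOn (fun t : ℝ => a * t ^ 3 + b * t ^ 2 + c * t + d)
      (Set.Icc (-T) T) := by fun_prop
  have := intermediate_value_Icc (by linarith : -T ≤ T) hcont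
  have h0 : (0 : ℝ) ∈ Set.Icc (a * (-T) ^ 3 + b * (-T) ^ 2 + c * (-T) + d)
      (a * T ^ 3 + b * T ^ 2 + c * T + d) := by
    constructor
    · have : a * (-T) ^ 3 + b * (-T) ^ 2 + c * (-T) + d
        = -(a * T ^ 3) + b * T ^ 2 - c * T + d := by ring
      rw [this]; nlinarith
    · nlinarith
  obtain ⟨θ, -, hθ⟩ := this h0
  exact ⟨θ, hθ⟩

/-- Real factorization of a cubic form with negative discriminant as linear times definite. -/
lemma exists_factor (x : Fin 4 → ℤ) (h0 : x 0 ≠ 0) (hD : cubicDisc x < 0) :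
    ∃ p q A B C : ℝ, 0 < A ∧ B ^ 2 < 4 * A * C ∧ (x 0 : ℝ) = p * A ∧ (x 1 : ℝ) = p * B + q * A ∧
      (x 2 : ℝ) = p * C + q * B ∧ (x 3 : ℝ) = q * C := by
  obtain ⟨e, he, hpos⟩ : ∃ e : ℝ, e ^ 2 = 1 ∧ 1 ≤ e * (x 0 : ℝ) := by
    rcases lt_or_gt_of_ne h0 with h | h
    · refine ⟨-1, by norm_num, ?_⟩
      have : 1 ≤ -1 * x 0 := by linarith
      exact_mod_cast this
    · refine ⟨1, by norm_num, ?_⟩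
      have : 1 ≤ 1 * x 0 := by linarith
      exact_mod_cast this
  obtain ⟨θ, hθ⟩ := exists_real_root_pos (e * x 0) (e * x 1) (e * x 2) (e * x 3) hpos
  have hD' : ((cubicDisc x : ℤ) : ℝ) < 0 := by exact_mod_cast hD
  simp only [cubicDisc] at hD'
  push_cast at hD'
  generalize (x 0 : ℝ) = a at *
  generalize (x 1 : ℝ) = b at *
  generalize (x 2 : ℝ) = c at *
  generalize (x 3 : ℝ) = d at *
  have hd : d = -θ * (c + b * θ + a * θ ^ 2) := by
    linear_combination e * hθ - (a * θ ^ 3 + b * θ ^ 2 + c * θ + d) * he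
  refine ⟨e, -e * θ, e * a, e * (b + a * θ), e * (c + b * θ + a * θ ^ 2), by linarith, ?_, ?_, ?_,
    ?_, ?_⟩
  · by_contra hcon
    push Not at hcon
    have h1 : 0 ≤ (b + a * θ) ^ 2 - 4 * a * (c + b * θ + a * θ ^ 2) := by
      have : (e * (b + a * θ)) ^ 2 - 4 * (e * a) * (e * (c + b * θ + a * θ ^ 2))
        = e ^ 2 * ((b + a * θ) ^ 2 - 4 * a * (c + b * θ + a * θ ^ 2)) := by ring
      rw [he, one_mul] at this
      linarith
    have h2 := mul_nonneg h1 (sq_nonneg (a * θ ^ 2 + (b + a * θ) * θ + (c + b * θ + a * θ ^ 2)))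
    rw [hd] at hD'
    nlinarith
  · linear_combination -a * he
  · linear_combination -b * he
  · linear_combination -c * he
  · linear_combination hd + θ * (c + b * θ + a * θ ^ 2) * he

set_option maxHeartbeats 1600000 in
lemma bdd_of_neg (m : ℤ) (hm : m < 0) (x : Fin 4 → ℤ) (hx : cubicDisc x = m) :
    ∃ γ : Matrix (Fin 2) (Fin 2) ℤ, γ.det = 1 ∧
      CoeffBdd (8 * |m| ^ 2 + 8 * |m|) (cubicAct γ x) := by
  by_cases h0 : x 0 = 0
  · exact bdd_of_zero m hm.ne x hx h0
  obtain ⟨p, q, A, B, C, hA, hQ, e0, e1, e2, e3⟩ := exists_factor x h0 (by rw [hx]; exact hm)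
  obtain ⟨a, b, c, d, hdet, hB, hC⟩ := quad_reduce A B C hA hQ
  have hdet' : (!![a, b; c, d] : Matrix (Fin 2) (Fin 2) ℤ).det = 1 := by
    rw [Matrix.det_fin_two_of]; exact hdet
  have hyD := cubicDisc_act _ hdet' x
  rw [hx] at hyD
  by_cases hy0 : cubicAct !![a, b; c, d] x 0 = 0
  · obtain ⟨g, hg, hb⟩ := bdd_of_zero m hm.ne _ hyD hy0
    refine ⟨g * !![a, b; c, d], by rw [Matrix.det_mul, hg, hdet', one_mul], ?_⟩
    rwa [← cubicAct_mul]
  refine ⟨!![a, b; c, d], hdet', ?_⟩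
  have hdetR : (a : ℝ) * d - b * c = 1 := by exact_mod_cast hdet
  obtain ⟨A', hA'⟩ : ∃ A', A' = A * a ^ 2 + B * a * b + C * b ^ 2 := ⟨_, rfl⟩
  obtain ⟨B', hB'⟩ : ∃ B', B' = 2 * A * a * c + B * (a * d + b * c) + 2 * C * b * d := ⟨_, rfl⟩
  obtain ⟨C', hC'⟩ : ∃ C', C' = A * c ^ 2 + B * c * d + C * d ^ 2 := ⟨_, rfl⟩
  obtain ⟨P, hP⟩ : ∃ P, P = p * a + q * b := ⟨_, rfl⟩
  obtain ⟨Q, hQ'⟩ : ∃ Q, Q = p * c + q * d := ⟨_, rfl⟩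
  rw [← hA', ← hB'] at hB
  rw [← hA', ← hC'] at hC
  have f0 : (cubicAct !![a, b; c, d] x 0 : ℝ) = P * A' := by
    simp [cubicAct, e0, e1, e2, e3, hP, hA']; ring
  have f1 : (cubicAct !![a, b; c, d] x 1 : ℝ) = P * B' + Q * A' := by
    simp [cubicAct, e0, e1, e2, e3, hP, hA', hQ', hB']; ring
  have f2 : (cubicAct !![a, b; c, d] x 2 : ℝ) = P * C' + Q * B' := by
    simp [cubicAct, e0, e1, e2, e3, hP, hC', hQ', hB']; ring
  have f3 : (cubicAct !![a, b; c, d] x 3 : ℝ) = Q * C' := by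
    simp [cubicAct, e0, e1, e2, e3, hC', hQ']; ring
  generalize cubicAct !![a, b; c, d] x = y at *
  clear hA' hB' hC' hP hQ' e0 e1 e2 e3 hA hQ hdet hdet' hdetR h0 hx
  obtain ⟨M, hM⟩ : ∃ M : ℤ, M = -m := ⟨_, rfl⟩
  have hM1 : 1 ≤ M := by omega
  have hM1R : (1 : ℝ) ≤ M := by exact_mod_cast hM1
  have hMR : (M : ℝ) = (4 * A' * C' - B' ^ 2) * (A' * Q ^ 2 - B' * P * Q + C' * P ^ 2) ^ 2 := by
    rw [hM, ← hyD]
    simp only [cubicDisc]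
    push_cast
    rw [f0, f1, f2, f3]
    ring
  have hy1 : 1 ≤ (P * A') ^ 2 := by
    have h := Int.one_le_abs hy0
    have h2 : 1 ≤ y 0 ^ 2 := by rw [← sq_abs]; nlinarith
    rw [← f0]
    exact_mod_cast h2
  have hA0 : 0 ≤ A' := le_trans (abs_nonneg _) hB
  have hC0 : 0 ≤ C' := hA0.trans hC
  have hBA : B' ^ 2 ≤ A' ^ 2 := by rw [← sq_abs]; nlinarith [abs_nonneg B']
  have hBAC : B' ^ 2 ≤ A' * C' := by nlinarith
  have hAC0 : 0 ≤ A' * C' := mul_nonneg hA0 hC0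
  obtain ⟨X, hX⟩ : ∃ X, X = A' * Q ^ 2 := ⟨_, rfl⟩
  obtain ⟨Y, hY⟩ : ∃ Y, Y = C' * P ^ 2 := ⟨_, rfl⟩
  have hX0 : 0 ≤ X := by rw [hX]; positivity
  have hY0 : 0 ≤ Y := by rw [hY]; positivity
  have hcross : 2 * (B' * P * Q) ≤ X + Y := by
    have h1 : (2 * (B' * P * Q)) ^ 2 ≤ (X + Y) ^ 2 := by
      have h2 := mul_le_mul_of_nonneg_right hBAC (sq_nonneg (P * Q))
      have h3 : A' * C' * (P * Q) ^ 2 = X * Y := by rw [hX, hY]; ring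
      nlinarith [sq_nonneg (X - Y)]
    exact le_trans (le_abs_self _) (abs_le_of_sq_le_sq h1 (by linarith))
  have hR : (X + Y) ^ 2 ≤ 4 * (A' * Q ^ 2 - B' * P * Q + C' * P ^ 2) ^ 2 := by
    rw [← hX, ← hY]; nlinarith
  have hmain : A' * C' * (X + Y) ^ 2 ≤ 2 * M := by
    have h1 : 3 * (A' * C') * (A' * Q ^ 2 - B' * P * Q + C' * P ^ 2) ^ 2 ≤ M := by
      rw [hMR]
      apply mul_le_mul_of_nonneg_right _ (sq_nonneg _)
      linarith
    have h2 := mul_le_mul_of_nonneg_left hR hAC0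
    linarith
  have hYY : A' * C' * Y ^ 2 ≤ 2 * M := by
    refine le_trans (mul_le_mul_of_nonneg_left ?_ hAC0) hmain
    clear * - hX0 hY0
    nlinarith [mul_nonneg hX0 hY0]
  have hXX : A' * C' * X ^ 2 ≤ 2 * M := by
    refine le_trans (mul_le_mul_of_nonneg_left ?_ hAC0) hmain
    clear * - hX0 hY0
    nlinarith [mul_nonneg hX0 hY0]
  have hXY : A' * C' * (X * Y) ≤ 2 * M := by
    refine le_trans (mul_le_mul_of_nonneg_left ?_ hAC0) hmain
    clear * - hX0 hY0
    nlinarith [mul_nonneg hX0 hY0]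
  have hAA : A' ^ 2 ≤ A' * C' := by
    rw [sq]; exact mul_le_mul_of_nonneg_left hC hA0
  -- the individual bounds
  have sq_bd : ∀ t : ℝ, t ^ 2 ≤ 2 * M → t ≤ 2 * M := by
    intro t h
    clear * - h hM1R
    nlinarith
  have b1 : (P * A') ^ 2 ≤ 2 * M := by
    apply sq_bd
    refine le_trans ?_ hYY
    have h1 : A' ^ 2 ≤ C' ^ 2 := pow_le_pow_left₀ hA0 hC 2
    have h2 : A' ^ 2 * A' ^ 2 ≤ (A' * C') * C' ^ 2 := mul_le_mul hAA h1 (sq_nonneg _) hAC0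
    have h3 := mul_le_mul_of_nonneg_right h2 (sq_nonneg (P ^ 2))
    rw [hY]
    linarith
  have b2 : (Q * A') ^ 2 ≤ 2 * M := by
    apply sq_bd
    refine le_trans ?_ hXX
    have h3 := mul_le_mul_of_nonneg_right hAA (sq_nonneg X)
    refine le_trans (le_of_eq ?_) h3
    rw [hX]; ring
  have b3 : (Q * C') ^ 2 ≤ 2 * M := by
    have h : (P * A') ^ 2 * (Q * C') ^ 2 ≤ 2 * M := by
      refine le_trans (le_of_eq ?_) hXY
      rw [hX, hY]; ring
    nlinarith [sq_nonneg (Q * C')]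
  have b4 : (P * C') ^ 2 ≤ 2 * M := by
    have h : (P * A') ^ 2 * (P * C') ^ 2 ≤ 2 * M := by
      refine le_trans (le_trans (le_of_eq ?_) (mul_le_mul_of_nonneg_right hAA (sq_nonneg Y))) hYY
      rw [hY]; ring
    nlinarith [sq_nonneg (P * C')]
  have b5 : (P * B') ^ 2 ≤ 2 * M := by
    refine le_trans ?_ b1
    rw [mul_pow, mul_pow]; gcongr
  have b6 : (Q * B') ^ 2 ≤ 2 * M := by
    refine le_trans ?_ b2
    rw [mul_pow, mul_pow]; gcongr
  have fin : ∀ n : ℤ, (n : ℝ) ^ 2 ≤ 8 * M → |n| ≤ 8 * |m| ^ 2 + 8 * |m| := by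
    intro n h
    have h' : n ^ 2 ≤ 8 * M := by exact_mod_cast h
    rw [abs_of_neg hm, ← hM]
    refine le_trans (abs_le_of_sq n (8 * M) (by omega) (by nlinarith)) (by nlinarith)
  intro i
  apply fin
  fin_cases i
  · show (y 0 : ℝ) ^ 2 ≤ _
    rw [f0]; linarith
  · show (y 1 : ℝ) ^ 2 ≤ _
    rw [f1]; nlinarith [sq_nonneg (P * B' - Q * A')]
  · show (y 2 : ℝ) ^ 2 ≤ _
    rw [f2]; nlinarith [sq_nonneg (P * C' - Q * B')]
  · show (y 3 : ℝ) ^ 2 ≤ _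
    rw [f3]; linarith

/-- For every nonzero integer `m`, the set of `SL₂(ℤ)`-orbits of integral binary cubic forms
of discriminant `m` is finite: the class number `h(m)` is finite. -/
theorem classNumber_finite (m : ℤ) (hm : m ≠ 0) :
    {O : Set (Fin 4 → ℤ) | ∃ x : Fin 4 → ℤ, cubicDisc x = m ∧
      O = {y | ∃ γ : Matrix (Fin 2) (Fin 2) ℤ, γ.det = 1 ∧ y = cubicAct γ x}}.Finite := by
  set N := 8 * |m| ^ 2 + 8 * |m| with hN
  have hfin : (Set.Icc (fun _ : Fin 4 => -N) (fun _ => N)).Finite := Set.finite_Icc _ _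
  refine (hfin.image (fun x : Fin 4 → ℤ =>
    {y | ∃ γ : Matrix (Fin 2) (Fin 2) ℤ, γ.det = 1 ∧ y = cubicAct γ x})).subset ?_
  rintro O ⟨x, hx, rfl⟩
  obtain ⟨g, hg, hb⟩ : ∃ γ : Matrix (Fin 2) (Fin 2) ℤ, γ.det = 1 ∧
      CoeffBdd N (cubicAct γ x) := by
    rcases lt_or_gt_of_ne hm with h | h
    · exact bdd_of_neg m h x hx
    · exact bdd_of_pos m h x hx
  refine ⟨cubicAct g x, ⟨fun i => (abs_le.mp (hb i)).1, fun i => (abs_le.mp (hb i)).2⟩, ?_⟩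
  ext y
  constructor
  · rintro ⟨h, hh, rfl⟩
    exact ⟨h * g, by rw [Matrix.det_mul, hh, hg, one_mul], cubicAct_mul _ _ _⟩
  · rintro ⟨h, hh, rfl⟩
    refine ⟨h * g.adjugate, ?_, ?_⟩
    · rw [Matrix.det_mul, hh, Matrix.det_adjugate, hg]; simp
    · rw [cubicAct_mul, Matrix.mul_assoc, Matrix.adjugate_mul, hg, one_smul, Matrix.mul_one]
end
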